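/- For every (N,M)-Dyck path D, dinv(D) = dinv'(D); that is, the area of ζ(D) equals the number of boxes □ of the Young diagram of D satisfying m·leg(□) < n·(arm(□)+1) and n·arm(□) ≤ m·(leg(□)+1) (equivalently leg(□)/(arm(□)+1) < n/m ≤ (leg(□)+1)/arm(□)). -/

import Mathlib

open scoped Classical

/-!
An `(N,M)`-Dyck path (`N = d*n` north steps, `M = d*m` west steps, with `n, m` coprime) is
encoded by its step word `w : List Bool`, read from `(M,0)` to `(0,N)`; `true` is a vertical
(north) step and `false` a horizontal (west) step.
-/

/-- A word encodes a `(d*n, d*m)`-Dyck path: it has `d*n + d*m` steps, `d*n` of them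
vertical, and all its lattice points `(x, y) = (d*m - h, v)` satisfy `n*x + m*y ≤ d*n*m`,
i.e. `m*v ≤ n*h` where `v`, `h` are the numbers of vertical resp. horizontal steps taken. -/
def IsDyckWord (n m d : ℕ) (w : List Bool) : Prop :=
  w.length = d * n + d * m ∧ w.count true = d * n ∧
    ∀ k ≤ w.length, m * ((w.take k).count true) ≤ n * ((w.take k).count false)

/-- The rank of the `k`-th step (0-indexed): the first step has rank `-m`, and each rank is
the previous one plus `n` if the previous step is horizontal, minus `m` if it is vertical. -/
def stepRank (n m : ℕ) (w : List Bool) (k : ℕ) : ℤ :=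
  -(m : ℤ) + ∑ j ∈ Finset.range k, (if w.getD j false then -(m : ℤ) else (n : ℤ))

/-- The sweep map `ζ`: rearrange the steps of `w` so that their ranks are weakly increasing,
steps of equal rank being arranged in the reversed order of their appearance in `w`. -/
def sweep (n m : ℕ) (w : List Bool) : List Bool :=
  ((List.range w.length).mergeSort (fun k k' =>
      decide (stepRank n m w k < stepRank n m w k' ∨
        (stepRank n m w k = stepRank n m w k' ∧ k' ≤ k)))).map
    (fun k => w.getD k false)

/-- The index in `w` of the unique vertical step lying in row `y` (the `(y+1)`-st `true`). -/
def vIdx (w : List Bool) (y : ℕ) : ℕ := (w.findIdxs (· == true)).getD y 0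

/-- The index in `w` of the unique horizontal step lying in column `x` (the `(M-x)`-th
`false`, since horizontal steps are traversed from column `M-1` down to column `0`). -/
def hIdx (M : ℕ) (w : List Bool) (x : ℕ) : ℕ := (w.findIdxs (· == false)).getD (M - 1 - x) 0

/-- The box `(x,y)` belongs to the Young diagram of the path `w` (the region weakly
below-left of the path) iff the vertical step in its row occurs before the horizontal step
in its column. -/
def inDiagram (M : ℕ) (w : List Bool) (x y : ℕ) : Prop := vIdx w y < hIdx M w x

/-- The rank of the box `(x,y)`: `rank(x,y) = d*m*n - m - n - n*x - m*y`; boxes of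
nonnegative rank are exactly those fitting below the diagonal. -/
def boxRank (n m d : ℕ) (x y : ℕ) : ℤ :=
  (d : ℤ) * m * n - m - n - n * x - m * y

/-- The area of a path: the number of boxes of nonnegative rank (those below the diagonal)
not in its Young diagram. -/
noncomputable def pathArea (n m d : ℕ) (w : List Bool) : ℕ :=
  ((Finset.range (d * m) ×ˢ Finset.range (d * n)).filter
    (fun p => 0 ≤ boxRank n m d p.1 p.2 ∧ ¬ inDiagram (d * m) w p.1 p.2)).card

/-- The height (`y`-coordinate) of the horizontal step of `w` in column `x`. -/
def hStepHeight (M : ℕ) (w : List Bool) (x : ℕ) : ℕ := (w.take (hIdx M w x)).count true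

/-- The column (`x`-coordinate) of the vertical step of `w` in row `y`. -/
def vStepCol (M : ℕ) (w : List Bool) (y : ℕ) : ℕ := M - (w.take (vIdx w y)).count false

/-- `arm(□)`: the number of boxes strictly between the box `□ = (x,y)` and the unique
vertical step `v_□` of the path lying in the same row as `□` (this is the assignment of
names forced by the rank identities `rank(h_□) = rank(□) - m(leg(□)+1)`,
`rank(v_□) = rank(□) - n·arm(□)` used in [GMV, Lemma 2.6]; the prose there interchanges
the two words). -/
def armBox (M : ℕ) (w : List Bool) (x y : ℕ) : ℕ :=
  if x < vStepCol M w y then vStepCol M w y - 1 - x else x - vStepCol M w y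

/-- `leg(□)`: the number of boxes strictly between the box `□ = (x,y)` and the unique
horizontal step `h_□` of the path lying in the same column as `□`. -/
def legBox (M : ℕ) (w : List Bool) (x y : ℕ) : ℕ :=
  if y < hStepHeight M w x then hStepHeight M w x - 1 - y else y - hStepHeight M w x

section Counting

/-- The change of rank caused by a step. -/
def stepWeight (n m : ℕ) (b : Bool) : ℤ := if b then -(m : ℤ) else (n : ℤ)

/-- The rank of the `k`-th step of `w` when the first step has rank `p`. -/
def rankFrom (n m : ℕ) (p : ℤ) (w : List Bool) (k : ℕ) : ℤ :=
  p + ∑ j ∈ Finset.range k, stepWeight n m (w.getD j false)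

theorem stepRank_eq_rankFrom (n m : ℕ) (w : List Bool) (k : ℕ) :
    stepRank n m w k = rankFrom n m (-m) w k := rfl

@[simp] theorem rankFrom_zero (n m : ℕ) (p : ℤ) (w : List Bool) : rankFrom n m p w 0 = p := by
  simp [rankFrom]

@[simp] theorem rankFrom_cons_succ (n m : ℕ) (p : ℤ) (a : Bool) (w : List Bool) (k : ℕ) :
    rankFrom n m p (a :: w) (k + 1) = rankFrom n m (p + stepWeight n m a) w k := by
  simp [rankFrom, Finset.sum_range_succ', add_assoc, add_comm]

/-- The number of steps of `w` in direction `b` whose rank satisfies `P`, the first step having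
rank `p`. -/
noncomputable def countSteps (n m : ℕ) (b : Bool) (P : ℤ → Prop) : ℤ → List Bool → ℕ
  | _, [] => 0
  | p, a :: w => (if a = b ∧ P p then 1 else 0) + countSteps n m b P (p + stepWeight n m a) w

theorem countSteps_eq_sum (n m : ℕ) (b : Bool) (P : ℤ → Prop) (p : ℤ) (w : List Bool) :
    countSteps n m b P p w = ∑ k ∈ Finset.range w.length,
      if w.getD k false = b ∧ P (rankFrom n m p w k) then 1 else 0 := by
  induction w generalizing p with
  | nil => simp [countSteps]
  | cons a w ih => simp [countSteps, Finset.sum_range_succ', ih, add_comm, -Finset.sum_boole]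

/-- The number of pairs of a vertical step of rank `r` and a horizontal step of rank `s` with
`r < s + n + m` if the vertical step comes first, and `r ≤ s` otherwise. -/
noncomputable def pairCount (n m : ℕ) : ℤ → List Bool → ℕ
  | _, [] => 0
  | p, true :: w => countSteps n m false (fun s => p < s + n + m) (p - m) w + pairCount n m (p - m) w
  | p, false :: w => countSteps n m true (fun r => r ≤ p) (p + n) w + pairCount n m (p + n) w

theorem pairCount_eq_sum (n m : ℕ) (p : ℤ) (w : List Bool) :
    pairCount n m p w = ∑ j ∈ Finset.range w.length, ∑ i ∈ Finset.range w.length,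
      if (w.getD j false = false ∧ w.getD i false = true) ∧
        ((i < j ∧ rankFrom n m p w i < rankFrom n m p w j + n + m) ∨
          (j < i ∧ rankFrom n m p w i ≤ rankFrom n m p w j)) then 1 else 0 := by
  induction w generalizing p with
  | nil => simp [pairCount]
  | cons a w ih =>
    cases a
    · simp [pairCount, Finset.sum_range_succ', ih, countSteps_eq_sum, stepWeight,
        add_comm, -Finset.sum_boole]
    · simp [pairCount, Finset.sum_range_succ', ih, countSteps_eq_sum, Finset.sum_add_distrib,
        stepWeight, add_comm, sub_eq_add_neg, -Finset.sum_boole]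

/-- The rank following the last step of `w`. -/
def endRank (n m : ℕ) (p : ℤ) (w : List Bool) : ℤ := p + n * w.count false - m * w.count true

theorem endRank_cons (n m : ℕ) (p : ℤ) (a : Bool) (w : List Bool) :
    endRank n m p (a :: w) = endRank n m (p + stepWeight n m a) w := by
  cases a <;> simp [endRank, stepWeight] <;> ring

theorem countSteps_append (n m : ℕ) (b : Bool) (P : ℤ → Prop) (p : ℤ) (u v : List Bool) :
    countSteps n m b P p (u ++ v) =
      countSteps n m b P p u + countSteps n m b P (endRank n m p u) v := by
  induction u generalizing p with
  | nil => simp [countSteps, endRank]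
  | cons a u ih => simp [countSteps, ih, endRank_cons, add_assoc]

/-- Crossings of the level `t` balance. -/
theorem countSteps_crossing (n m : ℕ) (t p : ℤ) (w : List Bool) :
    countSteps n m false (fun s => t - n < s) p w + countSteps n m true (fun r => r ≤ t) p w +
        (if t < p then 1 else 0) =
      countSteps n m false (fun s => t < s) p w + countSteps n m true (fun r => r ≤ t + m) p w +
        (if t < endRank n m p w then 1 else 0) := by
  induction w generalizing p with
  | nil => simp [countSteps, endRank]
  | cons a w ih =>
    have := ih (p + stepWeight n m a)
    cases a <;> simp only [countSteps, endRank_cons, stepWeight] at this ⊢ <;>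
      simp at this ⊢ <;> split_ifs at this ⊢ <;> omega

theorem pairCount_swap (n m : ℕ) (u t : List Bool) (p : ℤ)
    (h : endRank n m p (u ++ true :: false :: t) ≤ endRank n m p u - m) (hn : 0 < n) :
    pairCount n m p (u ++ true :: false :: t) + (if endRank n m p u + n ≤ p then 1 else 0) =
      pairCount n m p (u ++ false :: true :: t) := by
  induction u generalizing p with
  | nil =>
    have := countSteps_crossing n m (p - m) (p - m + n) t
    have e1 : (fun s : ℤ => p - m - n < s) = fun s => p < s + n + m := by
      funext s; exact propext ⟨fun h => by omega, fun h => by omega⟩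
    have e2 : (fun s : ℤ => p - m < s) = fun s => p + n < s + n + m := by
      funext s; exact propext ⟨fun h => by omega, fun h => by omega⟩
    have e3 : p + n - m = p - m + n := by ring
    have e4 : ¬ (p - m < endRank n m (p - m + n) t) := by
      simp [endRank] at h ⊢; linarith
    rw [e1, e2, if_neg e4, if_pos (by omega)] at this
    simp [pairCount, countSteps, stepWeight, ← sub_eq_add_neg, e3, endRank] at this ⊢
    rw [if_pos (by omega), if_neg (by omega)]
    omega
  | cons a u ih =>
    have := ih (p + stepWeight n m a) (by simpa [endRank_cons] using h)
    cases a
    · simp [pairCount, countSteps_append, endRank_cons, countSteps, stepWeight,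
        ← sub_eq_add_neg] at this ⊢
      have e : endRank n m (p + n) u + n - m = endRank n m (p + n) u - m + n := by ring
      rw [e]
      split_ifs at this ⊢ <;> omega
    · simp [pairCount, countSteps_append, endRank_cons, countSteps, stepWeight,
        ← sub_eq_add_neg] at this ⊢
      have e : endRank n m (p - m) u + n - m = endRank n m (p - m) u - m + n := by ring
      rw [e]
      split_ifs at this ⊢ <;> omega

end Counting

section Rearrangement

/-- The number of pairs of a vertical step and a later horizontal step. -/
def inversionCount : List Bool → ℕ
  | [] => 0
  | true :: w => w.count false + inversionCount w
  | false :: w => inversionCount w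

theorem inversionCount_swap (u t : List Bool) :
    inversionCount (u ++ true :: false :: t) = inversionCount (u ++ false :: true :: t) + 1 := by
  induction u with
  | nil => grind [inversionCount]
  | cons a u ih => cases a <;> grind [inversionCount]

theorem exists_swap_or_eq_replicate_append (w : List Bool) :
    (∃ u t, w = u ++ true :: false :: t) ∨
      w = List.replicate (w.count false) false ++ List.replicate (w.count true) true := by
  induction w with
  | nil => simp
  | cons a w ih =>
    obtain ⟨u, t, rfl⟩ | h := ih
    · exact Or.inl ⟨a :: u, t, rfl⟩
    · cases a
      · right
        simpa [List.replicate_succ] using h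
      · cases hc : w.count false with
        | zero =>
          right
          rw [hc] at h
          simpa [List.replicate_succ, hc] using h
        | succ c =>
          left
          rw [hc, List.replicate_succ] at h
          exact ⟨[], _, by rw [h]; rfl⟩

theorem pairCount_eq_of_nonneg (n m : ℕ) (hn : 0 < n) (w : List Bool)
    (hbal : m * w.count true = n * w.count false)
    (hpre : ∀ u v, w = u ++ v → m * u.count true ≤ n * u.count false) :
    pairCount n m (-m) w = pairCount n m (-m)
      (List.replicate (w.count false) false ++ List.replicate (w.count true) true) := by
  induction hk : inversionCount w generalizing w with
  | zero =>
    obtain ⟨u, t, rfl⟩ | h := exists_swap_or_eq_replicate_append w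
    · rw [inversionCount_swap] at hk; omega
    · rw [← h]
  | succ k ih =>
    obtain ⟨u, t, rfl⟩ | h := exists_swap_or_eq_replicate_append w
    · have h0 := hpre (u ++ [true]) (false :: t) (by simp)
      have hswap : ∀ u' v, u ++ false :: true :: t = u' ++ v →
          m * u'.count true ≤ n * u'.count false := by
        intro u' v h
        rw [List.append_eq_append_iff] at h
        obtain ⟨a, rfl, ha⟩ | ⟨c, rfl, -⟩ := h
        · match a, ha with
          | [], _ => exact hpre _ (true :: false :: t) (by simp)
          | [b], ha =>
            obtain ⟨rfl, -⟩ := List.cons.inj ha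
            have := hpre u (true :: false :: t) rfl
            simp at this ⊢
            nlinarith
          | b :: b' :: a, ha =>
            simp only [List.cons_append, List.cons.injEq] at ha
            obtain ⟨rfl, rfl, rfl⟩ := ha
            simpa [add_comm, add_left_comm] using hpre (u ++ true :: false :: a) v (by simp)
        · exact hpre u' (c ++ true :: false :: t) (by simp)
      have h1 : (0 : ℤ) ≤ endRank n m (-m) u := by
        simp only [endRank]
        simp at h0
        zify at h0
        linarith
      have h2 : endRank n m (-m) (u ++ true :: false :: t) = -m := by
        simp only [endRank]
        zify at hbal
        linarith
      have h3 := pairCount_swap n m u t (-m) (by rw [h2]; linarith) hn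
      rw [if_neg (by omega), add_zero] at h3
      have h4 := ih (u ++ false :: true :: t)
        (by simpa [add_comm, add_left_comm] using hbal) hswap
        (by rw [inversionCount_swap] at hk; omega)
      rw [h3, h4]
      simp
    · rw [← h]

theorem countSteps_replicate_of_ne (n m : ℕ) {a b : Bool} (hab : a ≠ b) (P : ℤ → Prop) (p : ℤ)
    (k : ℕ) : countSteps n m b P p (List.replicate k a) = 0 := by
  induction k generalizing p with
  | zero => rfl
  | succ k ih => simp [List.replicate_succ, countSteps, hab, ih]

theorem countSteps_replicate_true (n m : ℕ) (P : ℤ → Prop) (p : ℤ) (k : ℕ) :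
    countSteps n m true P p (List.replicate k true) =
      ∑ i ∈ Finset.range k, if P (p - m * i) then 1 else 0 := by
  induction k generalizing p with
  | zero => rfl
  | succ k ih =>
    rw [Finset.sum_range_succ']
    simp only [List.replicate_succ, countSteps, stepWeight, ih]
    simp [mul_add, sub_eq_add_neg, add_comm, add_assoc, -Finset.sum_boole]

theorem pairCount_replicate_true (n m : ℕ) (p : ℤ) (k : ℕ) :
    pairCount n m p (List.replicate k true) = 0 := by
  induction k generalizing p with
  | zero => rfl
  | succ k ih => simp [List.replicate_succ, pairCount, ih, countSteps_replicate_of_ne]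

theorem endRank_replicate_false (n m : ℕ) (p : ℤ) (k : ℕ) :
    endRank n m p (List.replicate k false) = p + n * k := by
  simp [endRank, List.count_replicate]

theorem pairCount_replicate_append (n m : ℕ) (p : ℤ) (a b : ℕ) :
    pairCount n m p (List.replicate a false ++ List.replicate b true) =
      ∑ j ∈ Finset.range a, ∑ i ∈ Finset.range b,
        if (n : ℤ) * (a - j) ≤ m * i then 1 else 0 := by
  induction a generalizing p with
  | zero => simp [pairCount_replicate_true]
  | succ a ih =>
    rw [Finset.sum_range_succ']
    simp only [List.replicate_succ, List.cons_append, pairCount, ih, countSteps_append,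
      countSteps_replicate_of_ne n m (show false ≠ true by decide), countSteps_replicate_true,
      endRank_replicate_false]
    rw [add_comm]
    congr 1
    · simp
    · rw [zero_add]
      refine Finset.sum_congr rfl fun i _ => ?_
      have e : p + n + n * a - m * i ≤ p ↔ (n : ℤ) * ((a + 1 : ℕ) - (0 : ℕ)) ≤ m * i := by
        push_cast
        constructor <;> intro h <;> linarith
      simp only [e]

end Rearrangement

section Boxes

/-- The index of the `(y+1)`-st step of `w` in direction `b`. -/
def nthStep (b : Bool) (w : List Bool) (y : ℕ) : ℕ := (w.findIdxs (· == b)).getD y 0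

theorem nthStep_cons_self_zero (b : Bool) (w : List Bool) : nthStep b (b :: w) 0 = 0 := by
  simp [nthStep]

theorem nthStep_cons_self_succ (b : Bool) (w : List Bool) {y : ℕ} (hy : y < w.count b) :
    nthStep b (b :: w) (y + 1) = nthStep b w y + 1 := by
  have hy' : y < w.countP (· == b) := hy
  simp [nthStep, List.findIdxs_start (s := 1), hy']

theorem nthStep_cons_of_ne {a b : Bool} (hab : a ≠ b) (w : List Bool) {y : ℕ}
    (hy : y < w.count b) : nthStep b (a :: w) y = nthStep b w y + 1 := by
  have hy' : y < w.countP (· == b) := hy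
  simp [nthStep, List.findIdxs_start (s := 1), hy', hab]

theorem nthStep_spec (b : Bool) (w : List Bool) {y : ℕ} (hy : y < w.count b) :
    nthStep b w y < w.length ∧ w.getD (nthStep b w y) false = b ∧
      (w.take (nthStep b w y)).count b = y := by
  induction w generalizing y with
  | nil => simp at hy
  | cons a w ih =>
    by_cases hab : a = b
    · subst hab
      cases y with
      | zero => simp [nthStep_cons_self_zero]
      | succ y =>
        have hy' : y < w.count a := by simpa using hy
        simpa [nthStep_cons_self_succ a w hy'] using ih hy'
    · have hy' : y < w.count b := by simpa [List.count_cons, hab] using hy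
      simpa [nthStep_cons_of_ne hab w hy', List.count_cons, hab] using ih hy'

theorem count_take_lt {b : Bool} {w : List Bool} {k : ℕ} (hk : k < w.length)
    (hb : w.getD k false = b) : (w.take k).count b < w.count b := by
  induction w generalizing k with
  | nil => simp at hk
  | cons a w ih =>
    cases k with
    | zero => simp at hb; simp [hb]
    | succ k =>
      have := ih (k := k) (by simpa using hk) (by simpa using hb)
      simp [List.count_cons]; omega

theorem nthStep_count_take {b : Bool} {w : List Bool} {k : ℕ} (hk : k < w.length)
    (hb : w.getD k false = b) : nthStep b w ((w.take k).count b) = k := by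
  induction w generalizing k with
  | nil => simp at hk
  | cons a w ih =>
    cases k with
    | zero => simp at hb; simp [hb, nthStep_cons_self_zero]
    | succ k =>
      have hk' : k < w.length := by simpa using hk
      have hb' : w.getD k false = b := by simpa using hb
      have h1 := ih hk' hb'
      have h2 := count_take_lt hk' hb'
      by_cases hab : a = b
      · subst hab
        simp [nthStep_cons_self_succ a w h2, h1]
      · simp [hab, nthStep_cons_of_ne hab w h2, h1]

theorem vIdx_eq_nthStep (w : List Bool) (y : ℕ) : vIdx w y = nthStep true w y := rfl

theorem hIdx_eq_nthStep (M : ℕ) (w : List Bool) (x : ℕ) :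
    hIdx M w x = nthStep false w (M - 1 - x) := rfl

/-- Boxes correspond to pairs of a horizontal and a vertical step. -/
theorem card_boxes_eq_card_pairs (w : List Bool) (P : ℕ → ℕ → Prop)
    [∀ j i, Decidable (P j i)] :
    ((Finset.range (w.count false) ×ˢ Finset.range (w.count true)).filter
      (fun p => P (hIdx (w.count false) w p.1) (vIdx w p.2))).card =
    ((Finset.range w.length ×ˢ Finset.range w.length).filter
      (fun q => (w.getD q.1 false = false ∧ w.getD q.2 false = true) ∧ P q.1 q.2)).card := by
  refine Finset.card_bij' (fun p _ => (hIdx (w.count false) w p.1, vIdx w p.2))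
    (fun q _ => (w.count false - 1 - (w.take q.1).count false, (w.take q.2).count true))
    ?_ ?_ ?_ ?_
  · rintro ⟨x, y⟩ h
    simp only [Finset.mem_filter, Finset.mem_product, Finset.mem_range] at h ⊢
    obtain ⟨⟨hx, hy⟩, hP⟩ := h
    have h1 := nthStep_spec false w (y := w.count false - 1 - x) (by omega)
    have h2 := nthStep_spec true w hy
    exact ⟨⟨h1.1, h2.1⟩, ⟨h1.2.1, h2.2.1⟩, hP⟩
  · rintro ⟨j, i⟩ h
    simp only [Finset.mem_filter, Finset.mem_product, Finset.mem_range] at h ⊢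
    obtain ⟨⟨hj, hi⟩, ⟨hj', hi'⟩, hP⟩ := h
    have h1 := count_take_lt hj hj'
    have h2 := count_take_lt hi hi'
    refine ⟨⟨by omega, h2⟩, ?_⟩
    rw [hIdx_eq_nthStep, vIdx_eq_nthStep, nthStep_count_take hi hi',
      show w.count false - 1 - (w.count false - 1 - (w.take j).count false) =
        (w.take j).count false by omega, nthStep_count_take hj hj']
    exact hP
  · rintro ⟨x, y⟩ h
    simp only [Finset.mem_filter, Finset.mem_product, Finset.mem_range] at h ⊢
    obtain ⟨⟨hx, hy⟩, hP⟩ := h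
    have h1 := nthStep_spec false w (y := w.count false - 1 - x) (by omega)
    have h2 := nthStep_spec true w hy
    rw [hIdx_eq_nthStep, vIdx_eq_nthStep, h1.2.2, h2.2.2]
    exact Prod.ext (by dsimp only; omega) rfl
  · rintro ⟨j, i⟩ h
    simp only [Finset.mem_filter, Finset.mem_product, Finset.mem_range] at h ⊢
    obtain ⟨⟨hj, hi⟩, ⟨hj', hi'⟩, hP⟩ := h
    have h1 := count_take_lt hj hj'
    rw [hIdx_eq_nthStep, vIdx_eq_nthStep, nthStep_count_take hi hi',
      show w.count false - 1 - (w.count false - 1 - (w.take j).count false) =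
        (w.take j).count false by omega, nthStep_count_take hj hj']

end Boxes

section Sweep

/-- The indices of the steps of `w`, in the order in which the sweep map lists them. -/
def sweepOrder (n m : ℕ) (w : List Bool) : List ℕ :=
  (List.range w.length).mergeSort (fun k k' =>
    decide (stepRank n m w k < stepRank n m w k' ∨
      (stepRank n m w k = stepRank n m w k' ∧ k' ≤ k)))

theorem sweep_eq_map (n m : ℕ) (w : List Bool) :
    sweep n m w = (sweepOrder n m w).map (fun k => w.getD k false) := rfl

theorem sweepOrder_perm (n m : ℕ) (w : List Bool) :
    (sweepOrder n m w).Perm (List.range w.length) := List.mergeSort_perm _ _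

theorem sweepOrder_pairwise (n m : ℕ) (w : List Bool) :
    (sweepOrder n m w).Pairwise (fun k k' => stepRank n m w k < stepRank n m w k' ∨
      (stepRank n m w k = stepRank n m w k' ∧ k' ≤ k)) := by
  have h := List.pairwise_mergeSort (le := fun k k' =>
    decide (stepRank n m w k < stepRank n m w k' ∨
      (stepRank n m w k = stepRank n m w k' ∧ k' ≤ k)))
    (by intro a b c; simp only [decide_eq_true_eq]; omega)
    (by intro a b; simp only [Bool.or_eq_true, decide_eq_true_eq]; omega)
    (List.range w.length)
  exact h.imp fun h => by simpa using h

@[simp] theorem length_sweepOrder (n m : ℕ) (w : List Bool) :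
    (sweepOrder n m w).length = w.length := by
  simpa using (sweepOrder_perm n m w).length_eq

@[simp] theorem length_sweep (n m : ℕ) (w : List Bool) :
    (sweep n m w).length = w.length := by
  simp [sweep_eq_map]

theorem nodup_sweepOrder (n m : ℕ) (w : List Bool) : (sweepOrder n m w).Nodup :=
  (sweepOrder_perm n m w).nodup_iff.mpr List.nodup_range

theorem mem_sweepOrder (n m : ℕ) (w : List Bool) (k : ℕ) :
    k ∈ sweepOrder n m w ↔ k < w.length := by
  simp [(sweepOrder_perm n m w).mem_iff]

theorem sweep_perm (n m : ℕ) (w : List Bool) : (sweep n m w).Perm w := by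
  refine ((sweepOrder_perm n m w).map _).trans (List.Perm.of_eq ?_)
  refine List.ext_getElem (by simp) fun i h1 h2 => ?_
  simp [h2]

/-- The area below the swept path counts the pairs of steps in increasing rank order. -/
theorem card_sweep_pairs (n m : ℕ) (w : List Bool) :
    ((Finset.range w.length ×ˢ Finset.range w.length).filter (fun q =>
      ((sweep n m w).getD q.1 false = false ∧ (sweep n m w).getD q.2 false = true) ∧
        q.2 < q.1)).card =
    ((Finset.range w.length ×ˢ Finset.range w.length).filter (fun q =>
      (w.getD q.1 false = false ∧ w.getD q.2 false = true) ∧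
        (stepRank n m w q.2 < stepRank n m w q.1 ∨
          (stepRank n m w q.2 = stepRank n m w q.1 ∧ q.1 < q.2)))).card := by
  have hget : ∀ k < w.length,
      (sweep n m w).getD k false = w.getD ((sweepOrder n m w).getD k 0) false := by
    intro k hk
    simp [sweep_eq_map, hk]
  have hlt : ∀ k < w.length, (sweepOrder n m w).getD k 0 < w.length := by
    intro k hk
    rw [← mem_sweepOrder n m w]
    simp [hk]
  have hsorted : ∀ i j, i < j → j < w.length →
      stepRank n m w ((sweepOrder n m w).getD i 0) < stepRank n m w ((sweepOrder n m w).getD j 0) ∨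
      (stepRank n m w ((sweepOrder n m w).getD i 0) =
          stepRank n m w ((sweepOrder n m w).getD j 0) ∧
        (sweepOrder n m w).getD j 0 ≤ (sweepOrder n m w).getD i 0) := by
    intro i j hij hj
    have := List.pairwise_iff_getElem.mp (sweepOrder_pairwise n m w) i j
      (by simp; omega) (by simp; omega) hij
    simpa [show i < w.length by omega, hj] using this
  have hinj : ∀ i < w.length, ∀ j < w.length,
      (sweepOrder n m w).getD i 0 = (sweepOrder n m w).getD j 0 → i = j := by
    intro i hi j hj h
    simp [hi, hj] at h
    exact (nodup_sweepOrder n m w).getElem_inj_iff.mp h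
  have hsurj : ∀ a < w.length, ∃ i < w.length, (sweepOrder n m w).getD i 0 = a := by
    intro a ha
    obtain ⟨i, hi, h⟩ := List.getElem_of_mem ((mem_sweepOrder n m w a).mpr ha)
    simp only [length_sweepOrder] at hi
    exact ⟨i, hi, by simpa [hi] using h⟩
  refine Finset.card_bij
    (fun q _ => ((sweepOrder n m w).getD q.1 0, (sweepOrder n m w).getD q.2 0)) ?_ ?_ ?_
  · rintro ⟨j, i⟩ h
    simp only [Finset.mem_filter, Finset.mem_product, Finset.mem_range] at h ⊢
    obtain ⟨⟨hj, hi⟩, ⟨hj', hi'⟩, hij⟩ := h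
    rw [hget _ hj] at hj'
    rw [hget _ hi] at hi'
    refine ⟨⟨hlt _ hj, hlt _ hi⟩, ⟨hj', hi'⟩, (hsorted i j hij hj).imp id fun h => ⟨h.1, ?_⟩⟩
    refine lt_of_le_of_ne h.2 fun he => ?_
    rw [he, hi'] at hj'
    exact absurd hj' (by decide)
  · rintro ⟨j, i⟩ h ⟨j', i'⟩ h' he
    simp only [Finset.mem_filter, Finset.mem_product, Finset.mem_range] at h h'
    simp only [Prod.mk.injEq] at he
    exact Prod.ext (hinj _ h.1.1 _ h'.1.1 he.1) (hinj _ h.1.2 _ h'.1.2 he.2)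
  · rintro ⟨b, a⟩ h
    simp only [Finset.mem_filter, Finset.mem_product, Finset.mem_range] at h
    obtain ⟨⟨hb, ha⟩, ⟨hb', ha'⟩, hab⟩ := h
    obtain ⟨j, hj, rfl⟩ := hsurj b hb
    obtain ⟨i, hi, rfl⟩ := hsurj a ha
    refine ⟨(j, i), ?_, rfl⟩
    simp only [Finset.mem_filter, Finset.mem_product, Finset.mem_range, hget _ hi, hget _ hj]
    refine ⟨⟨hj, hi⟩, ⟨hb', ha'⟩, ?_⟩
    by_contra hji
    obtain rfl | hji := (not_lt.mp hji).eq_or_lt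
    · omega
    · have := hsorted j i hji hi
      omega

/-- A closed walk has nonnegative total increment over the set of times at which it is low. -/
theorem sum_increments_nonneg (p : ℕ → ℤ) (L : ℕ) (hp : p L = p 0) (S : Finset ℕ)
    (hS : S ⊆ Finset.range L) (r : ℤ) (hlow : ∀ j ∈ S, p j ≤ r)
    (hhigh : ∀ j ∈ Finset.range L \ S, r ≤ p j) : 0 ≤ ∑ j ∈ S, (p (j + 1) - p j) := by
  have htotal : ∑ j ∈ Finset.range L, (min (p (j + 1)) r - min (p j) r) = 0 := by
    rw [Finset.sum_range_sub (fun j => min (p j) r), hp, sub_self]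
  rw [← Finset.sum_sdiff hS] at htotal
  have h1 : ∑ j ∈ Finset.range L \ S, (min (p (j + 1)) r - min (p j) r) ≤ 0 :=
    Finset.sum_nonpos fun j hj => by have := hhigh j hj; omega
  have h2 : ∑ j ∈ S, (min (p (j + 1)) r - min (p j) r) ≤ ∑ j ∈ S, (p (j + 1) - p j) :=
    Finset.sum_le_sum fun j hj => by have := hlow j hj; omega
  linarith

theorem sum_map_stepWeight (n m : ℕ) (v : List Bool) :
    (v.map (stepWeight n m)).sum = n * v.count false - m * v.count true := by
  induction v with
  | nil => simp
  | cons a v ih => cases a <;> simp [stepWeight, ih] <;> ring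

theorem rankFrom_length (n m : ℕ) (p : ℤ) (w : List Bool) :
    rankFrom n m p w w.length = endRank n m p w := by
  induction w generalizing p with
  | nil => simp [endRank]
  | cons a w ih => simp [endRank_cons, ih]

/-- The swept path stays below the diagonal. -/
theorem count_take_sweep_le (n m : ℕ) (w : List Bool)
    (hbal : m * w.count true = n * w.count false) (k : ℕ) :
    m * ((sweep n m w).take k).count true ≤ n * ((sweep n m w).take k).count false := by
  by_cases hk : w.length ≤ k
  · rw [List.take_of_length_le (by simpa using hk), (sweep_perm n m w).count_eq,
      (sweep_perm n m w).count_eq, hbal]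
  push Not at hk
  have hnodup := nodup_sweepOrder n m w
  have hk' : k < (sweepOrder n m w).length := by simpa using hk
  have hclosed : stepRank n m w w.length = stepRank n m w 0 := by
    rw [stepRank_eq_rankFrom, stepRank_eq_rankFrom, rankFrom_length, rankFrom_zero, endRank]
    zify at hbal
    linarith
  have key := sum_increments_nonneg (stepRank n m w) w.length hclosed
    ((sweepOrder n m w).take k).toFinset ?_ (stepRank n m w (sweepOrder n m w)[k]) ?_ ?_
  · have hstep : ∀ j, stepRank n m w (j + 1) - stepRank n m w j =
        stepWeight n m (w.getD j false) := by
      intro j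
      simp only [stepRank_eq_rankFrom, rankFrom, Finset.sum_range_succ]
      ring
    simp only [hstep] at key
    rw [List.sum_toFinset _ (hnodup.sublist (List.take_sublist k _)),
      show ((sweepOrder n m w).take k).map (fun j => stepWeight n m (w.getD j false)) =
        ((sweep n m w).take k).map (stepWeight n m) by
          rw [sweep_eq_map, ← List.map_take, List.map_map]; rfl,
      sum_map_stepWeight] at key
    zify
    linarith
  · intro j hj
    rw [List.mem_toFinset] at hj
    exact Finset.mem_range.mpr ((mem_sweepOrder n m w j).mp (List.mem_of_mem_take hj))
  · intro j hj
    rw [List.mem_toFinset, List.mem_take_iff_getElem] at hj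
    obtain ⟨i, hi, rfl⟩ := hj
    have := List.pairwise_iff_getElem.mp (sweepOrder_pairwise n m w) i k (by omega) hk' (by omega)
    omega
  · intro j hj
    rw [Finset.mem_sdiff, Finset.mem_range, ← mem_sweepOrder n m w, List.mem_toFinset,
      List.mem_take_iff_getElem] at hj
    obtain ⟨hj, hjk⟩ := hj
    obtain ⟨i, hi, rfl⟩ := List.getElem_of_mem hj
    have hki : k ≤ i := by
      by_contra h
      exact hjk ⟨i, by omega, rfl⟩
    obtain rfl | hki := hki.eq_or_lt
    · exact le_rfl
    · have := List.pairwise_iff_getElem.mp (sweepOrder_pairwise n m w) k i hk' hi hki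
      omega

end Sweep

section Dinv

theorem IsDyckWord.count_false {n m d : ℕ} {w : List Bool} (hw : IsDyckWord n m d w) :
    w.count false = d * m := by
  have h1 := List.count_true_add_count_false (l := w)
  have h2 := hw.1
  have h3 := hw.2.1
  omega

/-- The boxes below the diagonal are counted by the pairs of steps of any Dyck path. -/
theorem card_boxRank_nonneg (n m d : ℕ) (hn : 0 < n) (w : List Bool) (hw : IsDyckWord n m d w) :
    ((Finset.range (d * m) ×ˢ Finset.range (d * n)).filter
      (fun p => 0 ≤ boxRank n m d p.1 p.2)).card = pairCount n m (-m) w := by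
  have hf := hw.count_false
  obtain ⟨hlen, ht, hpre⟩ := hw
  rw [pairCount_eq_of_nonneg n m hn w (by rw [ht, hf]; ring)
    (by rintro u v rfl; simpa using hpre u.length (by simp)), hf, ht, pairCount_replicate_append,
    Finset.card_filter, Finset.sum_product, ← Finset.sum_range_reflect]
  refine Finset.sum_congr rfl fun j hj => ?_
  rw [← Finset.sum_range_reflect]
  refine Finset.sum_congr rfl fun i hi => ?_
  rw [Finset.mem_range] at hi hj
  have e : 0 ≤ boxRank n m d (d * m - 1 - j) (d * n - 1 - i) ↔
      (n : ℤ) * ((d * m : ℕ) - j) ≤ m * i := by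
    obtain ⟨a, ha⟩ := Nat.exists_eq_add_of_lt hj
    obtain ⟨b, hb⟩ := Nat.exists_eq_add_of_lt hi
    rw [boxRank, show d * m - 1 - j = a by omega, show d * n - 1 - i = b by omega]
    zify at ha hb
    push_cast
    rw [mul_right_comm, ha, hb]
    constructor <;> intro h <;> nlinarith
  simp only [e]

theorem inDiagram_sweep_boxRank_nonneg {n m d : ℕ} {w : List Bool} (hw : IsDyckWord n m d w)
    {x y : ℕ} (hx : x < d * m) (hy : y < d * n) (h : inDiagram (d * m) (sweep n m w) x y) :
    0 ≤ boxRank n m d x y := by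
  have hf := hw.count_false
  have ht := hw.2.1
  rw [← (sweep_perm n m w).count_eq] at hf ht
  have h1 := nthStep_spec false (sweep n m w) (y := d * m - 1 - x) (by omega)
  have h2 := nthStep_spec true (sweep n m w) (y := y) (by omega)
  have h3 := count_take_sweep_le n m w (by rw [hw.2.1, hw.count_false]; ring)
    (hIdx (d * m) (sweep n m w) x)
  have h4 : y < ((sweep n m w).take (hIdx (d * m) (sweep n m w) x)).count true := by
    have hlt : nthStep true (sweep n m w) y < hIdx (d * m) (sweep n m w) x := h
    have h5 := count_take_lt (b := true)
      (w := (sweep n m w).take (hIdx (d * m) (sweep n m w) x))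
      (k := nthStep true (sweep n m w) y) (by simp; have := h2.1; simp at this; omega)
      (by simpa [hlt, List.getElem?_take] using h2.2.1)
    rwa [List.take_take, min_eq_left hlt.le, h2.2.2] at h5
  rw [hIdx_eq_nthStep] at h3 h4
  rw [h1.2.2] at h3
  have h5 := (Nat.mul_le_mul_left m (Nat.succ_le_of_lt h4)).trans h3
  obtain ⟨a, ha⟩ := Nat.exists_eq_add_of_lt hx
  rw [show d * m - 1 - x = a by omega] at h5
  rw [boxRank]
  zify at ha h5
  rw [ha]
  linarith

theorem rankFrom_eq_take (n m : ℕ) (p : ℤ) (w : List Bool) {k : ℕ} (hk : k ≤ w.length) :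
    rankFrom n m p w k = p + n * (w.take k).count false - m * (w.take k).count true := by
  induction w generalizing p k with
  | nil => obtain rfl : k = 0 := by simpa using hk
           simp
  | cons a w ih =>
    cases k with
    | zero => simp
    | succ k =>
      rw [rankFrom_cons_succ, ih _ (by simpa using hk)]
      cases a <;> simp [stepWeight] <;> ring

theorem dinv_condition_iff {n m : ℕ} {w : List Bool} {x y : ℕ} (hx : x < w.count false)
    (hy : y < w.count true) (h : inDiagram (w.count false) w x y) :
    (m * legBox (w.count false) w x y < n * (armBox (w.count false) w x y + 1) ∧
      n * armBox (w.count false) w x y ≤ m * (legBox (w.count false) w x y + 1)) ↔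
    stepRank n m w (hIdx (w.count false) w x) ≤ stepRank n m w (vIdx w y) ∧
      stepRank n m w (vIdx w y) < stepRank n m w (hIdx (w.count false) w x) + n + m := by
  have h1 := nthStep_spec false w (y := w.count false - 1 - x) (by omega)
  have h2 := nthStep_spec true w hy
  rw [← hIdx_eq_nthStep] at h1
  rw [← vIdx_eq_nthStep] at h2
  have hlt : vIdx w y < hIdx (w.count false) w x := h
  have h4 : y < (w.take (hIdx (w.count false) w x)).count true := by
    have h5 := count_take_lt (b := true) (w := w.take (hIdx (w.count false) w x))
      (k := vIdx w y) (by simp; omega) (by simpa [hlt, List.getElem?_take] using h2.2.1)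
    rwa [List.take_take, min_eq_left hlt.le, h2.2.2] at h5
  have h5 : (w.take (vIdx w y)).count false ≤ w.count false - 1 - x := by
    rw [← h1.2.2, ← min_eq_left hlt.le, ← List.take_take]
    exact (List.take_sublist _ _).count_le _
  rw [stepRank_eq_rankFrom, stepRank_eq_rankFrom, rankFrom_eq_take _ _ _ _ h1.1.le,
    rankFrom_eq_take _ _ _ _ h2.1.le, h1.2.2, h2.2.2, legBox, armBox, hStepHeight, vStepCol,
    if_pos h4, if_pos (by omega)]
  generalize (w.take (hIdx (w.count false) w x)).count true = v at *
  generalize (w.take (vIdx w y)).count false = u at *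
  obtain ⟨a, ha⟩ := Nat.exists_eq_add_of_le h5
  obtain ⟨b, hb⟩ := Nat.exists_eq_add_of_lt h4
  rw [ha, show v - 1 - y = b by omega, show w.count false - u - 1 - x = a by omega, hb]
  zify
  constructor <;> rintro ⟨h6, h7⟩ <;> constructor <;> linarith

end Dinv

/-- For coprime positive `n, m` and `d ≥ 1`, and every `(d*n, d*m)`-Dyck
path `D`, one has `dinv(D) = dinv'(D)`: the area of `ζ(D)` equals the number of boxes `□`
of the Young diagram of `D` with `m·leg(□) < n·(arm(□)+1)` and `n·arm(□) ≤ m·(leg(□)+1)`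
(equivalently, `leg(□)/(arm(□)+1) < n/m ≤ (leg(□)+1)/arm(□)`). -/
theorem statement6 (n m d : ℕ) (hn : 0 < n) (hm : 0 < m) (hd : 0 < d)
    (hco : Nat.Coprime n m) (w : List Bool) (hw : IsDyckWord n m d w) :
    pathArea n m d (sweep n m w) =
      ((Finset.range (d * m) ×ˢ Finset.range (d * n)).filter
        (fun p => inDiagram (d * m) w p.1 p.2 ∧
          m * legBox (d * m) w p.1 p.2 < n * (armBox (d * m) w p.1 p.2 + 1) ∧
          n * armBox (d * m) w p.1 p.2 ≤ m * (legBox (d * m) w p.1 p.2 + 1))).card := by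
  have hf := hw.count_false
  have ht := hw.2.1
  have hperm := sweep_perm n m w
  have hsplit := Finset.card_filter_add_card_filter_not
    (s := (Finset.range (d * m) ×ˢ Finset.range (d * n)).filter
      (fun p => 0 ≤ boxRank n m d p.1 p.2))
    (fun p => inDiagram (d * m) (sweep n m w) p.1 p.2)
  rw [Finset.filter_filter, Finset.filter_filter, card_boxRank_nonneg n m d hn w hw,
    pairCount_eq_sum, ← Finset.sum_product', ← Finset.card_filter] at hsplit
  have harea : ((Finset.range (d * m) ×ˢ Finset.range (d * n)).filter (fun p =>
      0 ≤ boxRank n m d p.1 p.2 ∧ inDiagram (d * m) (sweep n m w) p.1 p.2)).card =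
      ((Finset.range w.length ×ˢ Finset.range w.length).filter (fun q =>
        (w.getD q.1 false = false ∧ w.getD q.2 false = true) ∧
          (stepRank n m w q.2 < stepRank n m w q.1 ∨
            (stepRank n m w q.2 = stepRank n m w q.1 ∧ q.1 < q.2)))).card := by
    have h := card_boxes_eq_card_pairs (sweep n m w) (fun j i => i < j)
    rw [length_sweep, card_sweep_pairs, hperm.count_eq, hperm.count_eq, hf, ht] at h
    rw [← h]
    congr 1
    refine Finset.filter_congr fun p hp => ?_
    rw [Finset.mem_product, Finset.mem_range, Finset.mem_range] at hp
    exact ⟨fun h => h.2, fun h => ⟨inDiagram_sweep_boxRank_nonneg hw hp.1 hp.2 h, h⟩⟩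
  have hdinv := card_boxes_eq_card_pairs w (fun j i => i < j ∧
    stepRank n m w j ≤ stepRank n m w i ∧ stepRank n m w i < stepRank n m w j + n + m)
  have hcond : ((Finset.range (d * m) ×ˢ Finset.range (d * n)).filter
        (fun p => inDiagram (d * m) w p.1 p.2 ∧
          m * legBox (d * m) w p.1 p.2 < n * (armBox (d * m) w p.1 p.2 + 1) ∧
          n * armBox (d * m) w p.1 p.2 ≤ m * (legBox (d * m) w p.1 p.2 + 1))).card =
      ((Finset.range w.length ×ˢ Finset.range w.length).filter (fun q =>
        (w.getD q.1 false = false ∧ w.getD q.2 false = true) ∧ q.2 < q.1 ∧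
          stepRank n m w q.1 ≤ stepRank n m w q.2 ∧
          stepRank n m w q.2 < stepRank n m w q.1 + n + m)).card := by
    refine Eq.trans ?_ hdinv
    rw [← hf, ← ht]
    congr 1
    refine Finset.filter_congr fun p hp => ?_
    rw [Finset.mem_product, Finset.mem_range, Finset.mem_range] at hp
    exact and_congr_right fun h => dinv_condition_iff hp.1 hp.2 h
  rw [hcond]
  rw [harea] at hsplit
  have hunion : ((Finset.range w.length ×ˢ Finset.range w.length).filter (fun q =>
      (w.getD q.1 false = false ∧ w.getD q.2 false = true) ∧
        ((q.2 < q.1 ∧ rankFrom n m (-m) w q.2 < rankFrom n m (-m) w q.1 + n + m) ∨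
          (q.1 < q.2 ∧ rankFrom n m (-m) w q.2 ≤ rankFrom n m (-m) w q.1)))).card =
      ((Finset.range w.length ×ˢ Finset.range w.length).filter (fun q =>
        (w.getD q.1 false = false ∧ w.getD q.2 false = true) ∧
          (stepRank n m w q.2 < stepRank n m w q.1 ∨
            (stepRank n m w q.2 = stepRank n m w q.1 ∧ q.1 < q.2)))).card +
      ((Finset.range w.length ×ˢ Finset.range w.length).filter (fun q =>
        (w.getD q.1 false = false ∧ w.getD q.2 false = true) ∧ q.2 < q.1 ∧
          stepRank n m w q.1 ≤ stepRank n m w q.2 ∧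
          stepRank n m w q.2 < stepRank n m w q.1 + n + m)).card := by
    rw [← Finset.card_union_of_disjoint, ← Finset.filter_or]
    · congr 1
      refine Finset.filter_congr fun q _ => ?_
      rw [← and_or_left]
      refine and_congr_right fun h => ?_
      have hne : q.1 ≠ q.2 := fun he => by
        rw [he, h.2] at h
        exact absurd h.1 (by decide)
      simp only [stepRank_eq_rankFrom]
      omega
    · refine Finset.disjoint_filter.mpr fun q _ h1 h2 => ?_
      omega
  rw [hunion] at hsplit
  exact Nat.add_left_cancel hsplit
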